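/- For every dimension n ≥ 1 there exist constants R_n > r_n > 0 such that for every bounded open convex set Ω ⊆ ℝⁿ whose center of mass is the origin O and whose inertia ellipsoid is the unit ball, one has B(O, r_n) ⊆ Ω ⊆ B(O, R_n). -/

import Mathlib

open MeasureTheory Metric

section CenteredConvexBody

variable {E : Type*} [NormedAddCommGroup E] [InnerProductSpace ℝ E] [FiniteDimensional ℝ E]
  [MeasurableSpace E] [BorelSpace E]

theorem Continuous.integrableOn_of_isBounded {μ : Measure E} [IsLocallyFiniteMeasure μ]
    {F : Type*} [NormedAddCommGroup F] {f : E → F} (hf : Continuous f) {s : Set E}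
    (hs : Bornology.IsBounded s) : IntegrableOn f s μ :=
  (hf.continuousOn.integrableOn_compact hs.isCompact_closure).mono_set subset_closure

/-- A linear functional on a convex body centered at the origin which is bounded above by `b` is
bounded below by a dimensional multiple of `-b`. -/
theorem neg_le_of_forall_le_of_integral_eq_zero (μ : Measure E) [μ.IsAddHaarMeasure]
    {Ω : Set E} (ho : IsOpen Ω) (hc : Convex ℝ Ω) (hb : Bornology.IsBounded Ω)
    (h0 : ∫ x in Ω, x ∂μ = 0) (f : E →L[ℝ] ℝ) {b : ℝ} (hfb : ∀ x ∈ Ω, f x ≤ b)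
    {q : E} (hq : q ∈ Ω) : -f q ≤ (2 ^ (Module.finrank ℝ E + 1) - 1) * b := by
  set V : ℝ := μ.real Ω
  set t : ℝ := (1 / 2 : ℝ) ^ Module.finrank ℝ E with ht
  have hfin : μ Ω ≠ ⊤ := hb.measure_lt_top.ne
  have hV : 0 < V := ENNReal.toReal_pos (ho.measure_pos μ ⟨q, hq⟩).ne' hfin
  have hfi : IntegrableOn f Ω μ := f.continuous.integrableOn_of_isBounded hb
  have hf0 : ∫ x in Ω, f x ∂μ = 0 := by
    rw [f.integral_comp_comm (φ := fun x => x)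
      (continuous_id.integrableOn_of_isBounded hb), h0, map_zero]
  set S : Set E := AffineMap.homothety q (1 / 2 : ℝ) '' Ω with hS
  have hSo : IsOpen S := AffineMap.homothety_isOpenMap q (1 / 2 : ℝ) (by norm_num) _ ho
  have hform : ∀ x, AffineMap.homothety q (1 / 2 : ℝ) x = (1 / 2 : ℝ) • x + (1 / 2 : ℝ) • q := by
    intro x
    rw [AffineMap.homothety_apply, vsub_eq_sub, vadd_eq_add]
    module
  have hSΩ : S ⊆ Ω := by
    rintro _ ⟨x, hx, rfl⟩
    rw [hform]
    exact hc hx hq (by norm_num) (by norm_num) (by norm_num)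
  have hSV : μ.real S = t * V := by
    rw [measureReal_def, hS, Measure.addHaar_image_homothety, ENNReal.toReal_mul,
      ENNReal.toReal_ofReal (abs_nonneg _), abs_of_nonneg (by positivity)]
    rfl
  have hsplit := setIntegral_union (disjoint_sdiff_self_right (x := S) (y := Ω))
    (ho.measurableSet.diff hSo.measurableSet) (hfi.mono_set hSΩ) (hfi.mono_set Set.sdiff_subset)
  rw [Set.union_sdiff_cancel hSΩ, hf0] at hsplit
  have h1 : ∫ x in S, f x ∂μ ≤ (b + f q) / 2 * (t * V) := by
    have := setIntegral_mono_on (hfi.mono_set hSΩ)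
      (integrableOn_const (C := (b + f q) / 2) (measure_ne_top_of_subset hSΩ hfin))
      hSo.measurableSet (by
        rintro _ ⟨x, hx, rfl⟩
        rw [hform]
        simp only [map_add, map_smul, smul_eq_mul]
        linarith [hfb x hx])
    rwa [setIntegral_const, smul_eq_mul, mul_comm, hSV] at this
  have h2 : ∫ x in Ω \ S, f x ∂μ ≤ b * (V - t * V) := by
    have := setIntegral_mono_on (hfi.mono_set (Set.sdiff_subset (t := S)))
      (integrableOn_const (C := b) (measure_ne_top_of_subset Set.sdiff_subset hfin))
      (ho.measurableSet.diff hSo.measurableSet) (fun x hx => hfb x hx.1)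
    rwa [setIntegral_const, smul_eq_mul, mul_comm,
      measureReal_sdiff hSΩ hSo.measurableSet hfin, hSV] at this
  have h3 : 0 ≤ ((b + f q) / 2 * t + b * (1 - t)) * V := by linarith
  have h4 : 0 ≤ (b + f q) / 2 * t + b * (1 - t) := nonneg_of_mul_nonneg_left h3 hV
  have h5 : t * 2 ^ Module.finrank ℝ E = 1 := by
    rw [ht, ← mul_pow]; norm_num
  have h6 := mul_nonneg h4 (by positivity : (0 : ℝ) ≤ 2 ^ Module.finrank ℝ E)
  rw [pow_succ]
  linear_combination 2 * h6 + (f q - b) * h5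

/-- The second moment of a functional over a set containing a ball on which it is large. -/
theorem sq_mul_measureReal_ball_le_setIntegral_sq {μ : Measure E} [μ.IsAddHaarMeasure]
    {s : Set E} (hb : Bornology.IsBounded s) (f : E →L[ℝ] ℝ) {z : E}
    {ρ a : ℝ} (ha : 0 ≤ a) (hz : ball z ρ ⊆ s) (hf : ∀ x ∈ ball z ρ, a ≤ f x) :
    a ^ 2 * μ.real (ball z ρ) ≤ ∫ x in s, f x ^ 2 ∂μ := by
  have hi : IntegrableOn (fun x => f x ^ 2) s μ :=
    (f.continuous.pow 2).integrableOn_of_isBounded hb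
  calc a ^ 2 * μ.real (ball z ρ) = ∫ _ in ball z ρ, a ^ 2 ∂μ := by
        rw [setIntegral_const, smul_eq_mul, mul_comm]
    _ ≤ ∫ x in ball z ρ, f x ^ 2 ∂μ :=
        setIntegral_mono_on (integrableOn_const measure_ball_lt_top.ne) (hi.mono_set hz)
          measurableSet_ball fun x hx => pow_le_pow_left₀ ha (hf x hx) 2
    _ ≤ ∫ x in s, f x ^ 2 ∂μ :=
        setIntegral_mono_set hi (.of_forall fun x => sq_nonneg _) hz.eventuallyLE

theorem setIntegral_sq_le_of_forall_abs_le {μ : Measure E} [IsLocallyFiniteMeasure μ]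
    {s : Set E} (hs : MeasurableSet s) (hb : Bornology.IsBounded s) (f : E →L[ℝ] ℝ) {a : ℝ}
    (hf : ∀ x ∈ s, |f x| ≤ a) : ∫ x in s, f x ^ 2 ∂μ ≤ a ^ 2 * μ.real s := by
  calc ∫ x in s, f x ^ 2 ∂μ ≤ ∫ _ in s, a ^ 2 ∂μ :=
        setIntegral_mono_on ((f.continuous.pow 2).integrableOn_of_isBounded hb)
          (integrableOn_const hb.measure_lt_top.ne) hs
          fun x hx => sq_le_sq.2 ((hf x hx).trans (le_abs_self a))
    _ = a ^ 2 * μ.real s := by rw [setIntegral_const, smul_eq_mul, mul_comm]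

theorem measureReal_ball_eq_pow_mul (μ : Measure E) [μ.IsAddHaarMeasure] (z : E) {ρ : ℝ}
    (hρ : 0 < ρ) : μ.real (ball z ρ) = ρ ^ Module.finrank ℝ E * μ.real (ball 0 1) := by
  rw [measureReal_def, Measure.addHaar_ball_of_pos μ z hρ, ENNReal.toReal_mul,
    ENNReal.toReal_ofReal (by positivity), measureReal_def]

theorem norm_sq_mul_le_setIntegral_ball_sq (μ : Measure E) [μ.IsAddHaarMeasure] (f : E →L[ℝ] ℝ) :
    ‖f‖ ^ 2 / 16 * ((1 / 4) ^ Module.finrank ℝ E * μ.real (ball (0 : E) 1)) ≤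
      ∫ x in ball (0 : E) 1, f x ^ 2 ∂μ := by
  rcases eq_or_ne f 0 with rfl | hf
  · simp
  set u := (InnerProductSpace.toDual ℝ E).symm f with hu
  have hun : ‖u‖ = ‖f‖ := LinearIsometryEquiv.norm_map _ _
  have hfu : ∀ x, f x = inner ℝ u x := fun x => by
    rw [hu, InnerProductSpace.toDual_symm_apply]
  have hpos : 0 < ‖f‖ := norm_pos_iff.2 hf
  set z : E := (1 / (2 * ‖f‖)) • u with hz
  have hzn : ‖z‖ = 1 / 2 := by
    rw [hz, norm_smul, hun, Real.norm_of_nonneg (by positivity)]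
    field_simp
  have hfz : f z = ‖f‖ / 2 := by
    rw [hfu, hz, inner_smul_right, real_inner_self_eq_norm_sq, hun]
    field_simp
  have hsub : ball z (1 / 4) ⊆ ball (0 : E) 1 :=
    ball_subset_ball' (by rw [dist_zero_right, hzn]; norm_num)
  have := sq_mul_measureReal_ball_le_setIntegral_sq (μ := μ) isBounded_ball f
    (a := ‖f‖ / 4) (by positivity) hsub (fun x hx => by
      have h1 : f (z - x) ≤ ‖f‖ * ‖z - x‖ := (le_abs_self _).trans (f.le_opNorm _)
      have h2 : ‖z - x‖ ≤ 1 / 4 := by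
        rw [← dist_eq_norm, dist_comm]; exact (mem_ball.1 hx).le
      rw [map_sub, hfz] at h1
      nlinarith)
  rw [measureReal_ball_eq_pow_mul μ z (by norm_num)] at this
  convert this using 2
  ring

theorem measureReal_le_of_setIntegral_norm_sq_le {μ : Measure E} [IsLocallyFiniteMeasure μ]
    {Ω : Set E} (ho : MeasurableSet Ω) (hb : Bornology.IsBounded Ω)
    (h : ∫ x in Ω, ‖x‖ ^ 2 ∂μ ≤ ∫ x in ball (0 : E) 1, ‖x‖ ^ 2 ∂μ) :
    μ.real Ω ≤ 2 * μ.real (ball (0 : E) 1) := by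
  have hi : ∀ {s : Set E}, Bornology.IsBounded s → IntegrableOn (fun x => ‖x‖ ^ 2) s μ :=
    fun hs => (continuous_norm.pow 2).integrableOn_of_isBounded hs
  have h1 : ∫ x in ball (0 : E) 1, ‖x‖ ^ 2 ∂μ ≤ μ.real (ball (0 : E) 1) := by
    have := setIntegral_mono_on (hi isBounded_ball)
      (integrableOn_const (C := (1 : ℝ)) isBounded_ball.measure_lt_top.ne)
      measurableSet_ball (fun x (hx : x ∈ ball (0 : E) 1) =>
        pow_le_one₀ (norm_nonneg x) (mem_ball_zero_iff.1 hx).le)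
    rwa [setIntegral_const, smul_eq_mul, mul_one] at this
  have h2 : μ.real (Ω \ ball (0 : E) 1) ≤ ∫ x in Ω \ ball (0 : E) 1, ‖x‖ ^ 2 ∂μ := by
    have := setIntegral_mono_on
      (integrableOn_const (C := (1 : ℝ)) (hb.subset Set.sdiff_subset).measure_lt_top.ne)
      (hi (hb.subset (Set.sdiff_subset (t := ball (0 : E) 1))))
      (ho.diff measurableSet_ball) (fun x hx =>
        one_le_pow₀ (not_lt.1 fun hlt => hx.2 (mem_ball_zero_iff.2 hlt)))
    rwa [setIntegral_const, smul_eq_mul, mul_one] at this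
  have h3 : ∫ x in Ω \ ball (0 : E) 1, ‖x‖ ^ 2 ∂μ ≤ ∫ x in Ω, ‖x‖ ^ 2 ∂μ :=
    setIntegral_mono_set (hi hb) (.of_forall fun x => sq_nonneg _)
      (Set.sdiff_subset (t := ball (0 : E) 1)).eventuallyLE
  have h4 : μ.real Ω ≤ μ.real (ball (0 : E) 1) + μ.real (Ω \ ball (0 : E) 1) :=
    (measureReal_mono (by rw [Set.union_sdiff_self]; exact Set.subset_union_right)
      (isBounded_ball.union (hb.subset Set.sdiff_subset)).measure_lt_top.ne).trans
      (measureReal_union_le _ _)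
  linarith

/-- Inner radius of a centered convex body whose inertia ellipsoid is the unit ball. -/
theorem ball_subset_of_inertia_eq (μ : Measure E) [μ.IsAddHaarMeasure]
    {Ω : Set E} (ho : IsOpen Ω) (hc : Convex ℝ Ω) (hb : Bornology.IsBounded Ω)
    (hne : Ω.Nonempty) (h0 : ∫ x in Ω, x ∂μ = 0)
    (hV : μ.real Ω ≤ 2 * μ.real (ball (0 : E) 1))
    (hin : ∀ f : E →L[ℝ] ℝ, ∫ x in Ω, f x ^ 2 ∂μ = ∫ x in ball (0 : E) 1, f x ^ 2 ∂μ) :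
    ball (0 : E) (1 / (16 * 4 ^ Module.finrank ℝ E)) ⊆ Ω := by
  intro y hy
  by_contra hyΩ
  obtain ⟨f, hf⟩ := geometric_hahn_banach_open_point hc ho hyΩ
  obtain ⟨q₀, hq₀⟩ := hne
  have hf0 : f ≠ 0 := by
    rintro rfl
    simpa using hf q₀ hq₀
  have hfpos : 0 < ‖f‖ := norm_pos_iff.2 hf0
  have hlow : ∀ q ∈ Ω, -f q ≤ (2 ^ (Module.finrank ℝ E + 1) - 1) * f y := fun q hq =>
    neg_le_of_forall_le_of_integral_eq_zero μ ho hc hb h0 f (fun x hx => (hf x hx).le) hq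
  have hD : (1 : ℝ) ≤ 2 ^ Module.finrank ℝ E := one_le_pow₀ (by norm_num)
  have hB : 0 < μ.real (ball (0 : E) 1) :=
    ENNReal.toReal_pos (measure_ball_pos μ 0 one_pos).ne' measure_ball_lt_top.ne
  set m := μ.real (ball (0 : E) 1)
  set D : ℝ := 2 ^ Module.finrank ℝ E with hDdef
  have h4 : (4 : ℝ) ^ Module.finrank ℝ E = D ^ 2 := by
    rw [hDdef, ← pow_mul, mul_comm, pow_mul]; norm_num
  have hfy : 0 ≤ f y := by
    have h1 := hlow q₀ hq₀
    have h2 := hf q₀ hq₀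
    rw [pow_succ, ← hDdef] at h1
    nlinarith
  have habs : ∀ x ∈ Ω, |f x| ≤ 2 * D * f y := by
    intro x hx
    have h1 := hlow x hx
    have h2 := hf x hx
    rw [pow_succ, ← hDdef] at h1
    rw [abs_le]
    constructor <;> nlinarith
  have hup := setIntegral_sq_le_of_forall_abs_le (μ := μ) ho.measurableSet hb f habs
  have hdn := norm_sq_mul_le_setIntegral_ball_sq μ f
  rw [← hin, one_div_pow, h4] at hdn
  have hfy' : f y ≤ ‖f‖ * (1 / (16 * D ^ 2)) := by
    rw [← h4]
    exact (le_abs_self _).trans ((f.le_opNorm y).trans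
      (mul_le_mul_of_nonneg_left (mem_ball_zero_iff.1 hy).le hfpos.le))
  have hsq : f y ^ 2 ≤ (‖f‖ * (1 / (16 * D ^ 2))) ^ 2 := pow_le_pow_left₀ hfy hfy' 2
  have hchain : ‖f‖ ^ 2 / 16 * (1 / D ^ 2 * m) ≤
      4 * D ^ 2 * (‖f‖ * (1 / (16 * D ^ 2))) ^ 2 * (2 * m) :=
    calc _ ≤ (2 * D * f y) ^ 2 * μ.real Ω := hdn.trans hup
      _ = 4 * D ^ 2 * f y ^ 2 * μ.real Ω := by ring
      _ ≤ _ := by gcongr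
  have heq : 4 * D ^ 2 * (‖f‖ * (1 / (16 * D ^ 2))) ^ 2 * (2 * m) =
      ‖f‖ ^ 2 / 16 * (1 / D ^ 2 * m) / 2 := by
    have : D ≠ 0 := by positivity
    field_simp
    norm_num
  have hp : 0 < ‖f‖ ^ 2 / 16 * (1 / D ^ 2 * m) := by positivity
  linarith

/-- Outer radius of a convex body containing a small ball and whose inertia ellipsoid is the unit
ball. -/
theorem subset_ball_of_inertia_eq (μ : Measure E) [μ.IsAddHaarMeasure]
    {Ω : Set E} (hc : Convex ℝ Ω) (hb : Bornology.IsBounded Ω)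
    {r : ℝ} (hr : 0 < r) (hr2 : r ≤ 2) (hball : ball (0 : E) r ⊆ Ω)
    (hin : ∀ f : E →L[ℝ] ℝ, ∫ x in Ω, f x ^ 2 ∂μ = ∫ x in ball (0 : E) 1, f x ^ 2 ∂μ) :
    Ω ⊆ ball (0 : E) (r + 4 * (2 / r) ^ Module.finrank ℝ E) := by
  intro p hp
  by_contra hpR
  rw [mem_ball_zero_iff, not_lt] at hpR
  set L := ‖p‖
  set K : ℝ := (2 / r) ^ Module.finrank ℝ E with hK
  have hK1 : 1 ≤ K := one_le_pow₀ ((one_le_div hr).2 hr2)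
  have hL : 0 < L := by linarith
  have hB : 0 < μ.real (ball (0 : E) 1) :=
    ENNReal.toReal_pos (measure_ball_pos μ 0 one_pos).ne' measure_ball_lt_top.ne
  set f : E →L[ℝ] ℝ := innerSL ℝ p
  have hf : ∀ x, f x = inner ℝ p x := fun x => innerSL_apply_apply ℝ p x
  have hsub : ball ((1 / 2 : ℝ) • p) (r / 2) ⊆ Ω := by
    intro x hx
    have hw : (2 : ℝ) • (x - (1 / 2 : ℝ) • p) ∈ ball (0 : E) r := by
      rw [mem_ball, dist_eq_norm] at hx
      rw [mem_ball_zero_iff, norm_smul, Real.norm_two]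
      linarith
    have := hc hp (hball hw) (a := 1 / 2) (b := 1 / 2) (by norm_num) (by norm_num) (by norm_num)
    convert this using 1
    module
  have hdn := sq_mul_measureReal_ball_le_setIntegral_sq (μ := μ) hb f
    (a := L * (2 * K)) (by positivity) hsub (fun x hx => by
      have h1 : inner ℝ p ((1 / 2 : ℝ) • p - x) ≤ L * ‖(1 / 2 : ℝ) • p - x‖ :=
        real_inner_le_norm _ _
      have h2 : ‖(1 / 2 : ℝ) • p - x‖ ≤ r / 2 := by
        rw [← dist_eq_norm, dist_comm]; exact (mem_ball.1 hx).le
      rw [inner_sub_right, inner_smul_right, real_inner_self_eq_norm_sq] at h1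
      rw [hf]
      have h3 := mul_le_mul_of_nonneg_left h2 hL.le
      have h4 := mul_le_mul_of_nonneg_left hpR hL.le
      change 1 / 2 * L ^ 2 - _ ≤ _ at h1
      linarith)
  have hup := setIntegral_sq_le_of_forall_abs_le (μ := μ) measurableSet_ball isBounded_ball f
    (s := ball (0 : E) 1) (a := L) (fun x hx => by
      rw [hf]
      exact (abs_real_inner_le_norm p x).trans
        (mul_le_of_le_one_right hL.le (mem_ball_zero_iff.1 hx).le))
  rw [measureReal_ball_eq_pow_mul μ _ (half_pos hr), hin] at hdn
  have hKr : K * (r / 2) ^ Module.finrank ℝ E = 1 := by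
    rw [hK, ← mul_pow, div_mul_div_cancel₀ hr.ne', div_self two_ne_zero, one_pow]
  have h := hdn.trans hup
  have heq : (L * (2 * K)) ^ 2 * ((r / 2) ^ Module.finrank ℝ E * μ.real (ball (0 : E) 1)) =
      4 * K * (L ^ 2 * μ.real (ball (0 : E) 1)) := by
    linear_combination (4 * L ^ 2 * K * μ.real (ball (0 : E) 1)) * hKr
  have hpos : 0 < L ^ 2 * μ.real (ball (0 : E) 1) := by positivity
  rw [heq] at h
  nlinarith

end CenteredConvexBody

/-- For every `n ≥ 1` there are constants `R_n > r_n > 0` such that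
every bounded open convex `Ω ⊆ ℝⁿ` with center of mass the origin and inertia ellipsoid
the unit ball satisfies `B(O, r_n) ⊆ Ω ⊆ B(O, R_n)`. -/
theorem stmt_10 (n : ℕ) (hn : 1 ≤ n) :
    ∃ r R : ℝ, 0 < r ∧ r < R ∧
      ∀ Ω : Set (EuclideanSpace ℝ (Fin n)),
        IsOpen Ω → Convex ℝ Ω → Bornology.IsBounded Ω → Ω.Nonempty →
        (∫ x in Ω, x = 0) →
        (∀ ψ : EuclideanSpace ℝ (Fin n) →ₗ[ℝ] ℝ,
          ∫ x in Ω, (ψ x) ^ 2 = ∫ x in ball (0 : EuclideanSpace ℝ (Fin n)) 1, (ψ x) ^ 2) →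
        ball (0 : EuclideanSpace ℝ (Fin n)) r ⊆ Ω ∧ Ω ⊆ ball (0 : EuclideanSpace ℝ (Fin n)) R := by
  set d := Module.finrank ℝ (EuclideanSpace ℝ (Fin n)) with hd
  set r : ℝ := 1 / (16 * 4 ^ d) with hr
  have hr0 : 0 < r := by positivity
  have hr2 : r ≤ 2 := by
    have : (1 : ℝ) ≤ 4 ^ d := one_le_pow₀ (by norm_num)
    rw [hr, div_le_iff₀ (by positivity)]
    linarith
  refine ⟨r, r + 4 * (2 / r) ^ d, hr0, lt_add_of_pos_right _ (by positivity), ?_⟩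
  intro Ω ho hc hb hne h0 hin
  have hin' : ∀ f : EuclideanSpace ℝ (Fin n) →L[ℝ] ℝ,
      ∫ x in Ω, f x ^ 2 = ∫ x in ball (0 : EuclideanSpace ℝ (Fin n)) 1, f x ^ 2 :=
    fun f => hin f.toLinearMap
  have hsum : ∀ s : Set (EuclideanSpace ℝ (Fin n)), Bornology.IsBounded s →
      ∫ x in s, ‖x‖ ^ 2 = ∑ i, ∫ x in s, (EuclideanSpace.proj i : _ →L[ℝ] ℝ) x ^ 2 := by
    intro s hs
    have hi : ∀ i ∈ Finset.univ, IntegrableOn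
        (fun x : EuclideanSpace ℝ (Fin n) => (EuclideanSpace.proj i : _ →L[ℝ] ℝ) x ^ 2) s :=
      fun i _ =>
        ((EuclideanSpace.proj i : _ →L[ℝ] ℝ).continuous.pow 2).integrableOn_of_isBounded hs
    rw [← integral_finsetSum _ hi]
    simp [EuclideanSpace.real_norm_sq_eq]
  have hV := measureReal_le_of_setIntegral_norm_sq_le (μ := volume) ho.measurableSet hb (by
    rw [hsum _ hb, hsum _ isBounded_ball]
    exact (Finset.sum_congr rfl fun i _ => hin' _).le)
  have hball := ball_subset_of_inertia_eq volume ho hc hb hne h0 hV hin'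
  exact ⟨hball, subset_ball_of_inertia_eq volume hc hb hr0 hr2 hball hin'⟩
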